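/- The assignment U ↦ ℬ(U) with termwise restriction maps is a sheaf on ℝ^N. Concretely, for any family {U_α}_{α∈I} of open sets in ℝ^N with U = ⋃_α U_α: (a) if F, G ∈ ℬ(U) satisfy F|_{U_α} = G|_{U_α} for every α, then F = G; and (b) if F_α ∈ ℬ(U_α) satisfy F_α|_{U_α∩U_β} = F_β|_{U_α∩U_β} whenever U_α ∩ U_β ≠ ∅, then there exists F ∈ ℬ(U) with F|_{U_α} = F_α for every α. -/

import Mathlib

open MeasureTheory Filter Topology Metric Pointwise

noncomputable section

/-- `ℝ^N` with the Euclidean metric. -/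
abbrev Euc (N : ℕ) : Type := EuclideanSpace ℝ (Fin N)

/-- `𝒟`: smooth real-valued functions with compact support on `ℝ^N`. -/
def IsTest {N : ℕ} (φ : Euc N → ℝ) : Prop :=
  ContDiff ℝ (⊤ : ℕ∞) φ ∧ HasCompactSupport φ

/-- `s(φ) = inf {ε > 0 : supp φ ⊆ B_ε}`. -/
def sRad {N : ℕ} (φ : Euc N → ℝ) : ℝ :=
  sInf {ε : ℝ | 0 < ε ∧ tsupport φ ⊆ ball (0 : Euc N) ε}

/-- `𝒟₀`: test functions that are nonnegative with integral 1. -/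
def IsD0 {N : ℕ} (φ : Euc N → ℝ) : Prop :=
  IsTest φ ∧ (∀ x, 0 ≤ φ x) ∧ (∫ x, φ x) = 1

/-- Delta sequences: sequences in `𝒟₀` with `s(φ_n) → 0`. -/
def IsDeltaSeq {N : ℕ} (φ : ℕ → Euc N → ℝ) : Prop :=
  (∀ n, IsD0 (φ n)) ∧ Tendsto (fun n => sRad (φ n)) atTop (𝓝 0)

/-- Convolution `(f∗φ)(x) = ∫ f(x−y)φ(y) dy` (with the convention that the
integrand vanishes wherever `φ` does). -/
def convol {N : ℕ} (f φ : Euc N → ℝ) : Euc N → ℝ :=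
  fun x => ∫ y, f (x - y) * φ y

/-- `A^{-ε} = (closure (Aᶜ + B_ε))ᶜ`. -/
def erode {N : ℕ} (A : Set (Euc N)) (ε : ℝ) : Set (Euc N) :=
  (closure (Aᶜ + ball (0 : Euc N) ε))ᶜ

/-- `‖f‖_K`, the sup of `|f|` over `K`. -/
def supNormOn {N : ℕ} (f : Euc N → ℝ) (K : Set (Euc N)) : ℝ :=
  ⨆ x ∈ K, |f x|

/-- Fundamental sequence on `U`: a sequence of continuous functions such that for
every compact `K ⊆ U` there is a delta sequence `δ` with `(f_n∗δ_m)_n` uniformly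
convergent on `K` for every `m` (all but finitely many `m`, per the paper's
convention on definedness of the convolutions). -/
def IsFundamental {N : ℕ} (f : ℕ → Euc N → ℝ) (U : Set (Euc N)) : Prop :=
  (∀ n, ContinuousOn (f n) U) ∧
  ∀ K : Set (Euc N), IsCompact K → K ⊆ U →
    ∃ δ : ℕ → Euc N → ℝ, IsDeltaSeq δ ∧ ∃ m₀ : ℕ, ∀ m ≥ m₀,
      ∃ g : Euc N → ℝ, TendstoUniformlyOn (fun n => convol (f n) (δ m)) g atTop K

/-- `(f_n) ∼ (g_n)` on `U`: for every compact `K ⊆ U` there is a delta sequence `φ`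
with `(f_n − g_n)∗φ_m ⇉ 0` on `K` as `n → ∞`, for every (sufficiently large) `m`. -/
def SimTo {N : ℕ} (f g : ℕ → Euc N → ℝ) (U : Set (Euc N)) : Prop :=
  ∀ K : Set (Euc N), IsCompact K → K ⊆ U →
    ∃ φ : ℕ → Euc N → ℝ, IsDeltaSeq φ ∧ ∃ m₀ : ℕ, ∀ m ≥ m₀,
      TendstoUniformlyOn (fun n => convol (fun y => f n y - g n y) (φ m)) 0 atTop K


/-- `φ ∈ 𝒟₀` with support in the ball of radius `ε`. -/
def SmallD0 {N : ℕ} (φ : Euc N → ℝ) (ε : ℝ) : Prop :=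
  IsD0 φ ∧ ∀ y, φ y ≠ 0 → ‖y‖ < ε

lemma SmallD0.cont {N : ℕ} {φ : Euc N → ℝ} {ε : ℝ} (h : SmallD0 φ ε) : Continuous φ :=
  h.1.1.1.continuous

lemma SmallD0.mono {N : ℕ} {φ : Euc N → ℝ} {ε ε' : ℝ} (h : SmallD0 φ ε) (hε : ε ≤ ε') :
    SmallD0 φ ε' := ⟨h.1, fun y hy => (h.2 y hy).trans_le hε⟩

lemma exists_smallD0 (N : ℕ) {ε : ℝ} (hε : 0 < ε) : ∃ φ : Euc N → ℝ, SmallD0 φ ε := by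
  let b : ContDiffBump (0 : Euc N) := ⟨ε / 2, ε, by linarith, by linarith⟩
  refine ⟨b.normed volume, ⟨⟨b.contDiff_normed, b.hasCompactSupport_normed⟩,
    fun x => b.nonneg_normed x, b.integral_normed⟩, fun y hy => ?_⟩
  have : y ∈ Function.support (b.normed volume) := hy
  rw [b.support_normed_eq] at this
  simpa using this

lemma IsD0.small_of_sRad {N : ℕ} {φ : Euc N → ℝ} (h : IsD0 φ) {ε : ℝ} (hs : sRad φ < ε) :
    SmallD0 φ ε := by
  have hne : {ε : ℝ | 0 < ε ∧ tsupport φ ⊆ ball (0 : Euc N) ε}.Nonempty := by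
    obtain ⟨r, hr⟩ := h.1.2.isCompact.isBounded.subset_ball (0 : Euc N)
    exact ⟨max r 1, by positivity, hr.trans (ball_subset_ball (le_max_left _ _))⟩
  obtain ⟨r, ⟨_, hr⟩, hlt⟩ := exists_lt_of_csInf_lt hne hs
  refine ⟨h, fun y hy => ?_⟩
  have := hr (subset_tsupport _ hy)
  rw [mem_ball_zero_iff] at this
  linarith

lemma SmallD0.sRad_le {N : ℕ} {φ : Euc N → ℝ} {ε : ℝ} (h : SmallD0 φ ε) (hε : 0 < ε) :
    sRad φ ≤ 2 * ε := by
  refine csInf_le ⟨0, fun r hr => hr.1.le⟩ ⟨by positivity, ?_⟩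
  have : tsupport φ ⊆ closedBall (0 : Euc N) ε :=
    closure_minimal (fun y hy => by simpa using (h.2 y hy).le) isClosed_closedBall
  exact this.trans (closedBall_subset_ball (by linarith))

lemma sRad_nonneg {N : ℕ} (φ : Euc N → ℝ) : 0 ≤ sRad φ :=
  Real.sInf_nonneg fun _ hr => hr.1.le

lemma isDeltaSeq_of_small {N : ℕ} {φ : ℕ → Euc N → ℝ}
    (h : ∀ n : ℕ, SmallD0 (φ n) (1 / ((n : ℝ) + 1))) : IsDeltaSeq φ := by
  refine ⟨fun n => (h n).1, ?_⟩
  have h1 : Tendsto (fun n : ℕ => 2 * (1 / ((n : ℝ) + 1))) atTop (𝓝 0) := by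
    simpa using (tendsto_one_div_add_atTop_nhds_zero_nat (𝕜 := ℝ)).const_mul 2
  exact squeeze_zero (fun n => sRad_nonneg _) (fun n => (h n).sRad_le (by positivity)) h1

lemma IsDeltaSeq.eventually_small {N : ℕ} {φ : ℕ → Euc N → ℝ} (h : IsDeltaSeq φ) {ε : ℝ}
    (hε : 0 < ε) : ∀ᶠ n in atTop, SmallD0 (φ n) ε := by
  filter_upwards [h.2.eventually_lt_const hε] with n hn
  exact (h.1 n).small_of_sRad hn

lemma convol_eq {N : ℕ} (f φ : Euc N → ℝ) :
    convol f φ = convolution φ f (ContinuousLinearMap.mul ℝ ℝ) volume := by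
  funext x
  simp [convol, convolution, mul_comm]

lemma convol_comm {N : ℕ} (f φ : Euc N → ℝ) : convol f φ = convol φ f := by
  rw [convol_eq, convol_eq, ← convolution_flip]
  congr 1
  ext
  simp

lemma tietze {N : ℕ} {f : Euc N → ℝ} {C : Set (Euc N)} (hC : IsClosed C) (hf : ContinuousOn f C) :
    ∃ g : Euc N → ℝ, Continuous g ∧ ∀ x ∈ C, g x = f x := by
  obtain ⟨g, hg⟩ := ContinuousMap.exists_restrict_eq hC ⟨C.domRestrict f, hf.domRestrict⟩
  refine ⟨g, g.continuous, fun x hx => ?_⟩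
  exact DFunLike.congr_fun hg ⟨x, hx⟩

lemma convol_congr {N : ℕ} {f g φ : Euc N → ℝ} {ε : ℝ} (hφ : SmallD0 φ ε) {x : Euc N}
    (h : ∀ y ∈ ball x ε, f y = g y) : convol f φ x = convol g φ x := by
  unfold convol
  congr 1
  funext y
  by_cases hy : φ y = 0
  · simp [hy]
  · rw [h]
    simpa [dist_eq_norm] using hφ.2 y hy

lemma integrable_convol {N : ℕ} {f φ : Euc N → ℝ} {ε : ℝ} (hφ : SmallD0 φ ε) {x : Euc N}
    (hf : ContinuousOn f (closedBall x ε)) : Integrable (fun y => f (x - y) * φ y) := by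
  obtain ⟨g, hg, hgf⟩ := tietze isClosed_closedBall hf
  have : (fun y => f (x - y) * φ y) = fun y => g (x - y) * φ y := by
    funext y
    by_cases hy : φ y = 0
    · simp [hy]
    · rw [hgf]
      simpa [dist_eq_norm] using (hφ.2 y hy).le
  rw [this]
  have hc := hφ.cont
  exact Continuous.integrable_of_hasCompactSupport (by fun_prop) hφ.1.1.2.mul_left

lemma SmallD0.integrable {N : ℕ} {φ : Euc N → ℝ} {ε : ℝ} (hφ : SmallD0 φ ε) : Integrable φ :=
  hφ.cont.integrable_of_hasCompactSupport hφ.1.1.2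

lemma convol_sub {N : ℕ} {f g φ : Euc N → ℝ} {ε : ℝ} (hφ : SmallD0 φ ε) {x : Euc N}
    (hf : ContinuousOn f (closedBall x ε)) (hg : ContinuousOn g (closedBall x ε)) :
    convol (fun y => f y - g y) φ x = convol f φ x - convol g φ x := by
  unfold convol
  rw [← integral_sub (integrable_convol hφ hf) (integrable_convol hφ hg)]
  simp only [sub_mul]

lemma convol_add {N : ℕ} {f g φ : Euc N → ℝ} {ε : ℝ} (hφ : SmallD0 φ ε) {x : Euc N}
    (hf : ContinuousOn f (closedBall x ε)) (hg : ContinuousOn g (closedBall x ε)) :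
    convol (fun y => f y + g y) φ x = convol f φ x + convol g φ x := by
  unfold convol
  rw [← integral_add (integrable_convol hφ hf) (integrable_convol hφ hg)]
  simp only [add_mul]

lemma convol_const {N : ℕ} {φ : Euc N → ℝ} (hφ : IsD0 φ) (c : ℝ) (x : Euc N) :
    convol (fun _ => c) φ x = c := by
  unfold convol
  rw [integral_const_mul, hφ.2.2, mul_one]

lemma convol_abs_le {N : ℕ} {f φ : Euc N → ℝ} {ε c : ℝ} (hφ : SmallD0 φ ε) {x : Euc N}
    (h : ∀ y ∈ ball x ε, |f y| ≤ c) : |convol f φ x| ≤ c := by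
  have h1 : ‖∫ y, f (x - y) * φ y‖ ≤ ∫ y, c * φ y := by
    refine norm_integral_le_of_norm_le (hφ.integrable.const_mul c) (Eventually.of_forall fun y => ?_)
    rw [norm_mul, Real.norm_eq_abs, Real.norm_of_nonneg (hφ.1.2.1 y)]
    by_cases hy : φ y = 0
    · simp [hy]
    · refine mul_le_mul_of_nonneg_right (h _ ?_) (hφ.1.2.1 y)
      simpa [dist_eq_norm] using hφ.2 y hy
  rwa [integral_const_mul, hφ.1.2.2, mul_one] at h1

lemma convol_sub_abs_le {N : ℕ} {f g φ : Euc N → ℝ} {ε c : ℝ} (hφ : SmallD0 φ ε) {x : Euc N}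
    (hf : ContinuousOn f (closedBall x ε)) (hg : ContinuousOn g (closedBall x ε))
    (h : ∀ y ∈ ball x ε, |f y - g y| ≤ c) : |convol f φ x - convol g φ x| ≤ c := by
  rw [← convol_sub hφ hf hg]
  exact convol_abs_le hφ h

lemma convol_continuous {N : ℕ} {f φ : Euc N → ℝ} {ε : ℝ} (hφ : SmallD0 φ ε) (hf : Continuous f) :
    Continuous (convol f φ) := by
  rw [convol_eq]
  exact hφ.1.1.2.continuous_convolution_left _ hφ.cont hf.locallyIntegrable

lemma convol_continuousOn {N : ℕ} {f φ : Euc N → ℝ} {ε : ℝ} (hφ : SmallD0 φ ε) {K : Set (Euc N)}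
    (hf : ContinuousOn f (cthickening ε K)) : ContinuousOn (convol f φ) K := by
  obtain ⟨g, hg, hgf⟩ := tietze isClosed_cthickening hf
  refine (convol_continuous hφ hg).continuousOn.congr fun x hx => ?_
  refine convol_congr hφ fun y hy => (hgf y ?_).symm
  exact (closedBall_subset_cthickening hx ε) (ball_subset_closedBall hy)

lemma SmallD0.convol {N : ℕ} {φ ψ : Euc N → ℝ} {a b : ℝ} (hφ : SmallD0 φ a) (hψ : SmallD0 ψ b) :
    SmallD0 (convol φ ψ) (a + b) := by
  refine ⟨⟨⟨?_, ?_⟩, fun x => ?_, ?_⟩, fun y hy => ?_⟩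
  · rw [convol_eq]
    exact hφ.1.1.2.contDiff_convolution_right _ hψ.cont.locallyIntegrable hφ.1.1.1
  · rw [convol_eq]
    exact hψ.1.1.2.convolution _ hφ.1.1.2
  · exact integral_nonneg fun y => mul_nonneg (hφ.1.2.1 _) (hψ.1.2.1 _)
  · rw [convol_eq, integral_convolution _ hψ.integrable hφ.integrable, hφ.1.2.2, hψ.1.2.2]
    simp
  · rw [convol_eq] at hy
    obtain ⟨u, hu, v, hv, rfl⟩ := support_convolution_subset _ (Function.mem_support.2 hy)
    have := hφ.2 v hv
    have := hψ.2 u hu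
    simp only
    linarith [norm_add_le u v]

lemma convol_assoc_global {N : ℕ} {f φ ψ : Euc N → ℝ} {a b : ℝ} (hφ : SmallD0 φ a)
    (hψ : SmallD0 ψ b) (hf : Continuous f) :
    convol (convol f φ) ψ = convol f (convol φ ψ) := by
  funext x
  simp only [convol_eq]
  symm
  have hcs : HasCompactSupport fun x => ‖φ x‖ := hφ.1.1.2.norm
  have hcs' : HasCompactSupport fun x => ‖ψ x‖ := hψ.1.1.2.norm
  refine convolution_assoc _ _ _ _ (by intro x y z; simp [mul_assoc])
    hψ.cont.aestronglyMeasurable hφ.cont.aestronglyMeasurable hf.aestronglyMeasurable ?_ ?_ ?_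
  · exact Eventually.of_forall fun y =>
      hψ.1.1.2.convolutionExists_left _ hψ.cont hφ.cont.locallyIntegrable y
  · exact Eventually.of_forall fun y =>
      hcs.convolutionExists_left _ hφ.cont.norm hf.norm.locallyIntegrable y
  · exact hcs'.convolutionExists_left _ hψ.cont.norm
      (hcs.continuous_convolution_left _ hφ.cont.norm hf.norm.locallyIntegrable).locallyIntegrable x

lemma convol_assoc {N : ℕ} {f φ ψ : Euc N → ℝ} {a b : ℝ} (hφ : SmallD0 φ a)
    (hψ : SmallD0 ψ b) {x : Euc N} (hf : ContinuousOn f (closedBall x (a + b))) :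
    convol (convol f φ) ψ x = convol f (convol φ ψ) x := by
  obtain ⟨g, hg, hgf⟩ := tietze isClosed_closedBall hf
  have h1 : convol f (convol φ ψ) x = convol g (convol φ ψ) x :=
    convol_congr (hφ.convol hψ) fun y hy => (hgf y (ball_subset_closedBall hy)).symm
  have h2 : convol (convol f φ) ψ x = convol (convol g φ) ψ x := by
    refine convol_congr hψ fun y hy => convol_congr hφ fun z hz => (hgf z ?_).symm
    simp only [mem_ball, mem_closedBall] at *
    linarith [dist_triangle z y x]
  rw [h1, h2, convol_assoc_global hφ hψ hg]

lemma convol_swap {N : ℕ} {f φ ψ : Euc N → ℝ} {a b : ℝ} (hφ : SmallD0 φ a)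
    (hψ : SmallD0 ψ b) {x : Euc N} (hf : ContinuousOn f (closedBall x (a + b))) :
    convol (convol f φ) ψ x = convol (convol f ψ) φ x := by
  rw [convol_assoc hφ hψ hf, convol_assoc hψ hφ (by rwa [add_comm]), convol_comm φ ψ]

/-- `h a ∗ φ → 0` uniformly on `K` along `l`. -/
def NullOn {N : ℕ} {A : Type*} (l : Filter A) (h : A → Euc N → ℝ) (φ : Euc N → ℝ)
    (K : Set (Euc N)) : Prop :=
  ∀ η : ℝ, 0 < η → ∀ᶠ a in l, ∀ x ∈ K, |convol (h a) φ x| ≤ η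

/-- For all compact `K ⊆ U` there are arbitrarily small `φ` with `h a ∗ φ → 0` on `K`. -/
def LocNull {N : ℕ} {A : Type*} (l : Filter A) (h : A → Euc N → ℝ) (U : Set (Euc N)) : Prop :=
  ∀ K : Set (Euc N), IsCompact K → K ⊆ U → ∀ ε : ℝ, 0 < ε → ∃ φ, SmallD0 φ ε ∧ NullOn l h φ K

lemma NullOn.mono {N : ℕ} {A : Type*} {l : Filter A} {h : A → Euc N → ℝ} {φ : Euc N → ℝ}
    {K K' : Set (Euc N)} (H : NullOn l h φ K) (hK : K' ⊆ K) : NullOn l h φ K' := fun η hη =>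
  (H η hη).mono fun _ ha x hx => ha x (hK hx)

lemma LocNull.mono {N : ℕ} {A : Type*} {l : Filter A} {h : A → Euc N → ℝ}
    {U U' : Set (Euc N)} (H : LocNull l h U) (hU : U' ⊆ U) : LocNull l h U' :=
  fun K hK hKU => H K hK (hKU.trans hU)

lemma LocNull.comp {N : ℕ} {A B : Type*} {l : Filter A} {l' : Filter B} {h : A → Euc N → ℝ}
    {U : Set (Euc N)} (H : LocNull l h U) {u : B → A} (hu : Tendsto u l' l) :
    LocNull l' (fun b => h (u b)) U := by
  intro K hK hKU ε hε
  obtain ⟨φ, hφ, hn⟩ := H K hK hKU ε hε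
  exact ⟨φ, hφ, fun η hη => hu.eventually (hn η hη)⟩

lemma convol_neg_fun {N : ℕ} (f φ : Euc N → ℝ) (x : Euc N) :
    convol (fun y => - f y) φ x = - convol f φ x := by
  unfold convol
  rw [← integral_neg]
  simp only [neg_mul]

lemma LocNull.neg {N : ℕ} {A : Type*} {l : Filter A} {h : A → Euc N → ℝ}
    {U : Set (Euc N)} (H : LocNull l h U) : LocNull l (fun a y => - h a y) U := by
  intro K hK hKU ε hε
  obtain ⟨φ, hφ, hn⟩ := H K hK hKU ε hε
  refine ⟨φ, hφ, fun η hη => (hn η hη).mono fun a ha x hx => ?_⟩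
  rw [convol_neg_fun, abs_neg]
  exact ha x hx

lemma locNull_empty {N : ℕ} {A : Type*} (l : Filter A) (h : A → Euc N → ℝ) :
    LocNull l h (∅ : Set (Euc N)) := by
  intro K _ hKU ε hε
  obtain ⟨φ, hφ⟩ := exists_smallD0 N hε
  exact ⟨φ, hφ, fun η _ => Eventually.of_forall fun a x hx => absurd (hKU hx) (by simp)⟩

lemma NullOn.absorb {N : ℕ} {A : Type*} {l : Filter A} {h : A → Euc N → ℝ} {φ ψ : Euc N → ℝ}
    {K U : Set (Euc N)} {r : ℝ} (hc : ∀ a, ContinuousOn (h a) U)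
    (hU : cthickening (r + r) K ⊆ U) (hφ : SmallD0 φ r) (hψ : SmallD0 ψ r)
    (H : NullOn l h φ (cthickening r K)) : NullOn l h (convol φ ψ) K := by
  intro η hη
  filter_upwards [H η hη] with a ha x hx
  rw [← convol_assoc hφ hψ ((hc a).mono ((closedBall_subset_cthickening hx _).trans hU))]
  exact convol_abs_le hψ fun y hy =>
    ha y (closedBall_subset_cthickening hx r (ball_subset_closedBall hy))

lemma exists_min_finset {κ : Type*} (T : Finset κ) (R : κ → ℝ) (hR : ∀ c, 0 < R c) :
    ∃ r : ℝ, 0 < r ∧ ∀ c ∈ T, r ≤ R c := by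
  classical
  induction T using Finset.induction_on with
  | empty => exact ⟨1, one_pos, by simp⟩
  | insert c T _ ih =>
    obtain ⟨r, hr, h⟩ := ih
    refine ⟨min r (R c), lt_min hr (hR c), fun d hd => ?_⟩
    rcases Finset.mem_insert.1 hd with rfl | hd
    · exact min_le_right _ _
    · exact (min_le_left _ _).trans (h d hd)

lemma merge {N : ℕ} {A κ : Type*} {l : Filter A} (T : Finset κ) {h : κ → A → Euc N → ℝ}
    {U : κ → Set (Euc N)} (hU : ∀ c, IsOpen (U c)) (hc : ∀ c a, ContinuousOn (h c a) (U c))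
    (H : ∀ c, LocNull l (h c) (U c)) (K : κ → Set (Euc N)) (hK : ∀ c, IsCompact (K c))
    (hKU : ∀ c, K c ⊆ U c) {ε : ℝ} (hε : 0 < ε) :
    ∃ φ, SmallD0 φ ε ∧ ∀ c ∈ T, NullOn l (h c) φ (K c) := by
  classical
  induction T using Finset.induction_on generalizing K ε with
  | empty =>
    obtain ⟨φ, hφ⟩ := exists_smallD0 N hε
    exact ⟨φ, hφ, by simp⟩
  | insert c T hcT ih =>
    have hR : ∀ c, ∃ R : ℝ, 0 < R ∧ cthickening R (K c) ⊆ U c := fun c =>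
      (hK c).exists_cthickening_subset_open (hU c) (hKU c)
    choose R hR0 hR using hR
    obtain ⟨r₀, hr₀, hrR⟩ := exists_min_finset (insert c T) R hR0
    set r := min r₀ ε / 2 with hr
    have hrpos : 0 < r := by positivity
    have hr1 : r + r ≤ r₀ := by rw [hr]; linarith [min_le_left r₀ ε]
    have hr2 : r + r ≤ ε := by rw [hr]; linarith [min_le_right r₀ ε]
    have hsub : ∀ d ∈ insert c T, cthickening (r + r) (K d) ⊆ U d := fun d hd =>
      (cthickening_mono (hr1.trans (hrR d hd)) _).trans (hR d)
    -- modify the compact sets outside of `T` so that they stay inside `U`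
    let K' : κ → Set (Euc N) := fun d => if d ∈ insert c T then cthickening r (K d) else K d
    have hK' : ∀ d, IsCompact (K' d) := fun d => by
      by_cases hd : d ∈ insert c T
      · simp only [K', if_pos hd]; exact (hK d).cthickening
      · simp only [K', if_neg hd]; exact hK d
    have hK'U : ∀ d, K' d ⊆ U d := fun d => by
      by_cases hd : d ∈ insert c T
      · simp only [K', if_pos hd]
        exact (cthickening_mono (by linarith) _).trans (hsub d hd)
      · simp only [K', if_neg hd]; exact hKU d
    have hKK : ∀ d ∈ insert c T, K' d = cthickening r (K d) := fun d hd => if_pos hd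
    obtain ⟨φ, hφ, hφT⟩ := ih K' hK' hK'U hrpos
    obtain ⟨ψ, hψ, hψc⟩ := H c (K' c) (hK' c) (hK'U c) r hrpos
    refine ⟨convol φ ψ, (hφ.convol hψ).mono hr2, fun d hd => ?_⟩
    rcases Finset.mem_insert.1 hd with rfl | hd'
    · rw [convol_comm]
      rw [hKK d hd] at hψc
      exact hψc.absorb (hc d) (hsub d hd) hψ hφ
    · have := hφT d hd'
      rw [hKK d hd] at this
      exact this.absorb (hc d) (hsub d hd) hφ hψ

lemma locNull_iUnion {N : ℕ} {A ι : Type*} {l : Filter A} {h : A → Euc N → ℝ}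
    {U : ι → Set (Euc N)} (hU : ∀ i, IsOpen (U i)) (hc : ∀ i a, ContinuousOn (h a) (U i))
    (H : ∀ i, LocNull l h (U i)) : LocNull l h (⋃ i, U i) := by
  intro K hK hKU ε hε
  have h1 : ∀ x : K, ∃ i, ∃ r : ℝ, 0 < r ∧ closedBall (x : Euc N) r ⊆ U i := fun x => by
    obtain ⟨i, hi⟩ := Set.mem_iUnion.1 (hKU x.2)
    obtain ⟨r, hr, hs⟩ := Metric.nhds_basis_closedBall.mem_iff.1 ((hU i).mem_nhds hi)
    exact ⟨i, r, hr, hs⟩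
  choose i r hr hs using h1
  obtain ⟨T, hT⟩ := hK.elim_nhds_subcover' (fun x hx => closedBall x (r ⟨x, hx⟩))
    (fun x hx => closedBall_mem_nhds _ (hr ⟨x, hx⟩))
  obtain ⟨φ, hφ, hn⟩ := merge (l := l) T (h := fun _ : K => h) (U := fun x => U (i x))
    (fun x => hU _) (fun x a => hc _ a) (fun x => H _) (fun x => closedBall (x : Euc N) (r x))
    (fun x => isCompact_closedBall _ _) hs hε
  refine ⟨φ, hφ, fun η hη => ?_⟩
  have := (Filter.eventually_all_finset T).2 fun x hx => hn x hx η hη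
  filter_upwards [this] with a ha x hx
  obtain ⟨y, hy, hxy⟩ := Set.mem_iUnion₂.1 (hT hx)
  exact ha y hy x hxy

lemma LocNull.add {N : ℕ} {A : Type*} {l : Filter A} {h h' : A → Euc N → ℝ}
    {U : Set (Euc N)} (hU : IsOpen U) (hc : ∀ a, ContinuousOn (h a) U)
    (hc' : ∀ a, ContinuousOn (h' a) U)
    (H : LocNull l h U) (H' : LocNull l h' U) : LocNull l (fun a y => h a y + h' a y) U := by
  intro K hK hKU ε hε
  obtain ⟨R, hR, hRU⟩ := hK.exists_cthickening_subset_open hU hKU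
  obtain ⟨φ, hφ, hn⟩ := merge (l := l) (Finset.univ : Finset Bool)
    (h := fun b => if b then h else h') (U := fun _ => U) (fun _ => hU)
    (by rintro (_ | _) a <;> simp [hc, hc']) (by rintro (_ | _) <;> simp [H, H']) (fun _ => K)
    (fun _ => hK) (fun _ => hKU) (lt_min hε hR)
  refine ⟨φ, hφ.mono (min_le_left _ _), fun η hη => ?_⟩
  have h1 := hn true (by simp) (η / 2) (by linarith)
  have h2 := hn false (by simp) (η / 2) (by linarith)
  filter_upwards [h1, h2] with a ha hb x hx
  have hsub : closedBall x R ⊆ U := (closedBall_subset_cthickening hx _).trans hRU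
  rw [convol_add (hφ.mono (min_le_right _ _)) ((hc a).mono hsub) ((hc' a).mono hsub)]
  have ha' := ha x hx
  have hb' := hb x hx
  simp only [if_true, Bool.false_eq_true, if_false] at ha' hb'
  linarith [abs_add_le (convol (h a) φ x) (convol (h' a) φ x)]

lemma simTo_of_locNull {N : ℕ} {f g : ℕ → Euc N → ℝ} {U : Set (Euc N)}
    (H : LocNull atTop (fun n y => f n y - g n y) U) : SimTo f g U := by
  intro K hK hKU
  choose φ hφ hn using fun m : ℕ => H K hK hKU (1 / ((m : ℝ) + 1)) (by positivity)
  refine ⟨φ, isDeltaSeq_of_small hφ, 0, fun m _ => ?_⟩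
  rw [Metric.tendstoUniformlyOn_iff]
  intro η hη
  filter_upwards [hn m (η / 2) (by linarith)] with n h x hx
  have := h x hx
  simp only [Pi.zero_apply, dist_zero_left, Real.norm_eq_abs]
  linarith

lemma SimTo.locNull {N : ℕ} {f g : ℕ → Euc N → ℝ} {U : Set (Euc N)}
    (H : SimTo f g U) : LocNull atTop (fun n y => f n y - g n y) U := by
  intro K hK hKU ε hε
  obtain ⟨φ, hφ, m₀, hm⟩ := H K hK hKU
  obtain ⟨m, hs, hmm⟩ := ((hφ.eventually_small hε).and (eventually_ge_atTop m₀)).exists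
  refine ⟨φ m, hs, fun η hη => ?_⟩
  filter_upwards [Metric.tendstoUniformlyOn_iff.1 (hm m hmm) η hη] with n h x hx
  have := h x hx
  simp only [Pi.zero_apply, dist_zero_left, Real.norm_eq_abs] at this
  exact this.le

lemma exists_lim_of_uniformCauchy {N : ℕ} {u : ℕ → Euc N → ℝ} {K : Set (Euc N)}
    (h : UniformCauchySeqOn u atTop K) : ∃ g, TendstoUniformlyOn u g atTop K := by
  have h1 : ∀ x, ∃ y, x ∈ K → Tendsto (fun n => u n x) atTop (𝓝 y) := fun x => by
    by_cases hx : x ∈ K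
    · obtain ⟨y, hy⟩ := cauchySeq_tendsto_of_complete (h.cauchySeq hx)
      exact ⟨y, fun _ => hy⟩
    · exact ⟨0, fun h => absurd h hx⟩
  choose g hg using h1
  exact ⟨g, h.tendstoUniformlyOn_of_tendsto hg⟩

lemma NullOn.uniformCauchy {N : ℕ} {f : ℕ → Euc N → ℝ} {φ : Euc N → ℝ} {r : ℝ} {K : Set (Euc N)}
    (hφ : SmallD0 φ r) (hc : ∀ n, ContinuousOn (f n) (cthickening r K))
    (H : NullOn (atTop : Filter (ℕ × ℕ)) (fun p y => f p.1 y - f p.2 y) φ K) :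
    UniformCauchySeqOn (fun n => convol (f n) φ) atTop K := by
  rw [Metric.uniformCauchySeqOn_iff]
  intro η hη
  obtain ⟨⟨a, b⟩, hab⟩ := eventually_atTop.1 (H (η / 2) (by linarith))
  refine ⟨max a b, fun m hm n hn x hx => ?_⟩
  have h1 := hab (m, n) ⟨(le_max_left _ _).trans hm, (le_max_right _ _).trans hn⟩ x hx
  have hsub := closedBall_subset_cthickening hx r
  simp only at h1
  rw [convol_sub hφ ((hc m).mono hsub) ((hc n).mono hsub)] at h1
  rw [Real.dist_eq]
  linarith

lemma isFundamental_of_locNull {N : ℕ} {f : ℕ → Euc N → ℝ} {U : Set (Euc N)} (hU : IsOpen U)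
    (hc : ∀ n, ContinuousOn (f n) U)
    (H : LocNull (atTop : Filter (ℕ × ℕ)) (fun p y => f p.1 y - f p.2 y) U) :
    IsFundamental f U := by
  refine ⟨hc, fun K hK hKU => ?_⟩
  obtain ⟨R, hR, hRU⟩ := hK.exists_cthickening_subset_open hU hKU
  choose φ hφ hn using fun m : ℕ => H K hK hKU (min (1 / ((m : ℝ) + 1)) R)
    (lt_min (by positivity) hR)
  refine ⟨φ, isDeltaSeq_of_small fun m => (hφ m).mono (min_le_left _ _), 0, fun m _ => ?_⟩
  exact exists_lim_of_uniformCauchy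
    ((hn m).uniformCauchy ((hφ m).mono (min_le_right _ _)) fun n => (hc n).mono hRU)

lemma IsFundamental.locNull {N : ℕ} {f : ℕ → Euc N → ℝ} {U : Set (Euc N)} (hU : IsOpen U)
    (H : IsFundamental f U) :
    LocNull (atTop : Filter (ℕ × ℕ)) (fun p y => f p.1 y - f p.2 y) U := by
  intro K hK hKU ε hε
  obtain ⟨R, hR, hRU⟩ := hK.exists_cthickening_subset_open hU hKU
  obtain ⟨φ, hφ, m₀, hm⟩ := H.2 K hK hKU
  obtain ⟨m, hs, hmm⟩ := ((hφ.eventually_small (lt_min hε hR)).and (eventually_ge_atTop m₀)).exists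
  refine ⟨φ m, hs.mono (min_le_left _ _), fun η hη => ?_⟩
  obtain ⟨g, hg⟩ := hm m hmm
  obtain ⟨n₀, hn₀⟩ := Metric.uniformCauchySeqOn_iff.1 hg.uniformCauchySeqOn η hη
  filter_upwards [eventually_ge_atTop (n₀, n₀)] with p hp x hx
  have hsub := (closedBall_subset_cthickening hx R).trans hRU
  rw [convol_sub (hs.mono (min_le_right _ _)) ((H.1 _).mono hsub) ((H.1 _).mono hsub)]
  exact (hn₀ p.1 hp.1 p.2 hp.2 x hx).le

lemma tendsto_fst_nat : Tendsto (Prod.fst : ℕ × ℕ → ℕ) atTop atTop := by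
  rw [← prod_atTop_atTop_eq]; exact tendsto_fst

lemma tendsto_snd_nat : Tendsto (Prod.snd : ℕ × ℕ → ℕ) atTop atTop := by
  rw [← prod_atTop_atTop_eq]; exact tendsto_snd

lemma cross_locNull {N : ℕ} {f g : ℕ → Euc N → ℝ} {U : Set (Euc N)} (hU : IsOpen U)
    (hf : ∀ n, ContinuousOn (f n) U) (hg : ∀ n, ContinuousOn (g n) U)
    (H : LocNull (atTop : Filter (ℕ × ℕ)) (fun p y => f p.1 y - f p.2 y) U)
    (H' : LocNull atTop (fun n y => f n y - g n y) U) :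
    LocNull (atTop : Filter (ℕ × ℕ)) (fun p y => f p.1 y - g p.2 y) U := by
  have := LocNull.add hU (fun p : ℕ × ℕ => (hf p.1).sub (hf p.2))
    (fun p : ℕ × ℕ => (hf p.2).sub (hg p.2)) H
    (H'.comp tendsto_snd_nat)
  simpa using this

lemma glue_step {N : ℕ} {L V : ℕ → Set (Euc N)} (hV : ∀ j, IsOpen (V j))
    (hL : ∀ j, IsCompact (L j)) (hLV : ∀ j, L j ⊆ V j) {G : ℕ → ℕ → Euc N → ℝ}
    (hG : ∀ j n, ContinuousOn (G j n) (V j))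
    (H : ∀ j k, LocNull (atTop : Filter (ℕ × ℕ)) (fun p y => G j p.1 y - G k p.2 y) (V j ∩ V k))
    (n : ℕ) {ε : ℝ} (hε : 0 < ε) :
    ∃ f φ : Euc N → ℝ, Continuous f ∧ SmallD0 φ ε ∧
      ∀ j ≤ n, TendstoUniformlyOn (fun k => convol (G j k) φ) f atTop (L j) := by
  have hR : ∀ j, ∃ R : ℝ, 0 < R ∧ cthickening R (L j) ⊆ V j := fun j =>
    (hL j).exists_cthickening_subset_open (hV j) (hLV j)
  choose R hR0 hR using hR
  obtain ⟨r, hr, hrR⟩ := exists_min_finset (Finset.range (n + 1)) R hR0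
  have hsub : ∀ j ≤ n, cthickening r (L j) ⊆ V j := fun j hj =>
    (cthickening_mono (hrR j (by simpa [Nat.lt_succ_iff] using hj)) _).trans (hR j)
  obtain ⟨φ, hφ, hn⟩ := merge (Finset.range (n + 1) ×ˢ Finset.range (n + 1))
    (h := fun c : ℕ × ℕ => fun (p : ℕ × ℕ) y => G c.1 p.1 y - G c.2 p.2 y)
    (U := fun c => V c.1 ∩ V c.2) (l := atTop) (fun c => (hV _).inter (hV _))
    (fun c p => ((hG _ _).mono Set.inter_subset_left).sub ((hG _ _).mono Set.inter_subset_right))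
    (fun c => H _ _) (fun c => L c.1 ∩ L c.2) (fun c => (hL _).inter (hL _))
    (fun c => Set.inter_subset_inter (hLV _) (hLV _)) (lt_min hε hr)
  have hφr := hφ.mono (min_le_right _ _)
  have hnull : ∀ j ≤ n, ∀ k ≤ n, NullOn (atTop : Filter (ℕ × ℕ))
      (fun p y => G j p.1 y - G k p.2 y) φ (L j ∩ L k) := fun j hj k hk =>
    hn (j, k) (by simp; omega)
  have hUC : ∀ j ≤ n, UniformCauchySeqOn (fun k => convol (G j k) φ) atTop (L j) := fun j hj => by
    have := hnull j hj j hj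
    rw [Set.inter_self] at this
    exact this.uniformCauchy hφr fun k => (hG j k).mono (hsub j hj)
  have hlim : ∀ x, ∃ y : ℝ, ∀ j ≤ n, x ∈ L j →
      Tendsto (fun k => convol (G j k) φ x) atTop (𝓝 y) := by
    intro x
    by_cases hx : ∃ j ≤ n, x ∈ L j
    · obtain ⟨j, hj, hxj⟩ := hx
      obtain ⟨y, hy⟩ := cauchySeq_tendsto_of_complete ((hUC j hj).cauchySeq hxj)
      refine ⟨y, fun k hk hxk => ?_⟩
      have h0 : Tendsto (fun m => convol (G k m) φ x - convol (G j m) φ x) atTop (𝓝 0) := by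
        rw [Metric.tendsto_atTop]
        intro η hη
        obtain ⟨⟨a, b⟩, hab⟩ := eventually_atTop.1 (hnull k hk j hj (η / 2) (by linarith))
        refine ⟨max a b, fun m hm => ?_⟩
        have h1 := hab (m, m) ⟨(le_max_left _ _).trans hm, (le_max_right _ _).trans hm⟩ x
          ⟨hxk, hxj⟩
        simp only at h1
        rw [convol_sub hφr
          ((hG k m).mono ((closedBall_subset_cthickening hxk r).trans (hsub k hk)))
          ((hG j m).mono ((closedBall_subset_cthickening hxj r).trans (hsub j hj)))] at h1
        rw [Real.dist_eq, sub_zero]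
        linarith
      simpa using h0.add hy
    · exact ⟨0, fun j hj hxj => absurd ⟨j, hj, hxj⟩ hx⟩
  choose g hg using hlim
  have hunif : ∀ j ≤ n, TendstoUniformlyOn (fun k => convol (G j k) φ) g atTop (L j) :=
    fun j hj => (hUC j hj).tendstoUniformlyOn_of_tendsto fun x hx => hg x j hj hx
  have hgc : ∀ j ≤ n, ContinuousOn g (L j) := fun j hj =>
    (hunif j hj).continuousOn (Eventually.of_forall fun k =>
      convol_continuousOn hφr ((hG j k).mono (hsub j hj))).frequently
  have hgU : ContinuousOn g (⋃ j : Fin (n + 1), L j) :=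
    (locallyFinite_of_finite _).continuousOn_iUnion (fun j => (hL j).isClosed)
      fun j => hgc j (Nat.lt_succ_iff.1 j.2)
  obtain ⟨f, hf, hfg⟩ := tietze (isClosed_iUnion_of_finite fun j : Fin (n + 1) => (hL j).isClosed)
    hgU
  refine ⟨f, φ, hf, hφ.mono (min_le_left _ _), fun j hj => (hunif j hj).congr_right ?_⟩
  intro x hx
  exact (hfg x (Set.mem_iUnion.2 ⟨⟨j, Nat.lt_succ_iff.2 hj⟩, hx⟩)).symm

lemma approx_unif {N : ℕ} {H : Euc N → ℝ} {L : Set (Euc N)} (hL : IsCompact L)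
    (hH : ContinuousOn H L) {η : ℝ} (hη : 0 < η) :
    ∃ ρ : ℝ, 0 < ρ ∧ ∀ φ, ∀ r, 0 < r → r ≤ ρ → SmallD0 φ r → ∀ x, closedBall x r ⊆ L →
      |convol H φ x - H x| ≤ η := by
  obtain ⟨ρ, hρ, h⟩ := Metric.uniformContinuousOn_iff.1 (hL.uniformContinuousOn_of_continuous hH)
    η hη
  refine ⟨ρ, hρ, fun φ r hr hrρ hφ x hx => ?_⟩
  have h1 := convol_sub_abs_le (g := fun _ => H x) (c := η) hφ (hH.mono hx) continuousOn_const
    (fun y hy => by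
      have := h y (hx (ball_subset_closedBall hy)) x (hx (mem_closedBall_self hr.le))
        (lt_of_lt_of_le hy hrρ)
      exact this.le)
  rwa [convol_const hφ.1] at h1

lemma glue {N : ℕ} {L V : ℕ → Set (Euc N)} (hV : ∀ j, IsOpen (V j))
    (hL : ∀ j, IsCompact (L j)) (hLV : ∀ j, L j ⊆ V j) {G : ℕ → ℕ → Euc N → ℝ}
    (hG : ∀ j n, ContinuousOn (G j n) (V j))
    (H : ∀ j k, LocNull (atTop : Filter (ℕ × ℕ)) (fun p y => G j p.1 y - G k p.2 y) (V j ∩ V k)) :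
    ∃ f : ℕ → Euc N → ℝ, (∀ n, Continuous (f n)) ∧
      ∀ j, LocNull atTop (fun n y => f n y - G j n y) (interior (L j)) := by
  choose f φ hf hφ hlim using fun n : ℕ =>
    glue_step hV hL hLV hG H n (ε := 1 / ((n : ℝ) + 1)) (by positivity)
  refine ⟨f, hf, fun j K hK hKL ε hε => ?_⟩
  obtain ⟨R, hR, hRL⟩ := hK.exists_cthickening_subset_open isOpen_interior hKL
  replace hRL := hRL.trans interior_subset
  obtain ⟨R', hR', hRV⟩ := (hL j).exists_cthickening_subset_open (hV j) (hLV j)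
  set r := min (R / 2) R' with hr
  have hr0 : 0 < r := by positivity
  have hrR : r + r ≤ R := by linarith [min_le_left (R / 2) R']
  have hrR' : r ≤ R' := min_le_right _ _
  have hself := H j j
  rw [Set.inter_self] at hself
  obtain ⟨δ, hδ, hnull⟩ := hself (L j) (hL j) (hLV j) (min ε r) (lt_min hε hr0)
  have hδr := hδ.mono (min_le_right ε r)
  have hLr : cthickening r (L j) ⊆ V j := (cthickening_mono hrR' _).trans hRV
  have hHc : ∀ k, ContinuousOn (convol (G j k) δ) (L j) := fun k =>
    convol_continuousOn hδr ((hG j k).mono hLr)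
  have hUC : UniformCauchySeqOn (fun k => convol (G j k) δ) atTop (L j) :=
    hnull.uniformCauchy hδr fun k => (hG j k).mono hLr
  refine ⟨δ, hδ.mono (min_le_left _ _), fun η hη => ?_⟩
  have hη4 : 0 < η / 4 := by linarith
  obtain ⟨k₀, hk₀⟩ := Metric.uniformCauchySeqOn_iff.1 hUC (η / 4) hη4
  obtain ⟨ρ, hρ, hap⟩ := approx_unif (hL j) (hHc k₀) hη4
  have hsmall : ∀ᶠ n in atTop, SmallD0 (φ n) (min ρ r) := by
    have h1 : IsDeltaSeq φ := isDeltaSeq_of_small hφ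
    exact h1.eventually_small (lt_min hρ hr0)
  filter_upwards [hsmall, eventually_ge_atTop j, eventually_ge_atTop k₀] with n hs hnj hnk x hx
  have hxL : closedBall x (r + r) ⊆ L j :=
    (closedBall_subset_closedBall hrR).trans ((closedBall_subset_cthickening hx R).trans hRL)
  have hxL1 : closedBall x r ⊆ L j := (closedBall_subset_closedBall (by linarith)).trans hxL
  have hxx : x ∈ L j := hxL1 (mem_closedBall_self hr0.le)
  have hsr := hs.mono (min_le_right ρ r)
  obtain ⟨k, hk1, hk2⟩ := ((Metric.tendstoUniformlyOn_iff.1 (hlim n j hnj) (η / 4) hη4).and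
    (eventually_ge_atTop k₀)).exists
  rw [convol_sub hδr (hf n).continuousOn ((hG j n).mono (hxL1.trans (hLV j)))]
  have e1 : |convol (f n) δ x - convol (convol (G j k) (φ n)) δ x| ≤ η / 4 := by
    refine convol_sub_abs_le hδr (hf n).continuousOn ?_ fun y hy => ?_
    · refine convol_continuousOn hsr ((hG j k).mono ?_)
      exact (cthickening_subset_of_subset _ hxL1).trans hLr
    · exact (hk1 y (hxL1 (ball_subset_closedBall hy))).le
  rw [convol_swap hsr hδr ((hG j k).mono (hxL.trans (hLV j)))] at e1
  have e2 : |convol (convol (G j k) δ) (φ n) x - convol (convol (G j k₀) δ) (φ n) x| ≤ η / 4 :=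
    convol_sub_abs_le hsr ((hHc k).mono hxL1) ((hHc k₀).mono hxL1) fun y hy =>
      (hk₀ k hk2 k₀ le_rfl y (hxL1 (ball_subset_closedBall hy))).le
  have e3 : |convol (convol (G j k₀) δ) (φ n) x - convol (G j k₀) δ x| ≤ η / 4 := by
    exact hap _ _ (lt_min hρ hr0) (min_le_left _ _) hs x
      ((closedBall_subset_closedBall (min_le_right _ _)).trans hxL1)
  have e4 : |convol (G j k₀) δ x - convol (G j n) δ x| ≤ η / 4 := (hk₀ k₀ le_rfl n hnk x hxx).le
  rw [abs_le] at *
  constructor <;> linarith [e1.1, e1.2, e2.1, e2.2, e3.1, e3.2, e4.1, e4.2]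

/-- The Boehmians form a sheaf on `ℝ^N`: for any family `{U_α}` of open sets with
union `U`, (a) Boehmians on `U` agreeing on each `U_α` are equal, and (b) a
compatible family of Boehmians `F_α ∈ ℬ(U_α)` glues to some `F ∈ ℬ(U)`. -/
theorem boehmians_sheaf {N : ℕ} {ι : Type*} (Uα : ι → Set (Euc N))
    (hopen : ∀ i, IsOpen (Uα i)) :
    (∀ f g : ℕ → Euc N → ℝ,
      IsFundamental f (⋃ i, Uα i) → IsFundamental g (⋃ i, Uα i) →
      (∀ i, SimTo f g (Uα i)) → SimTo f g (⋃ i, Uα i)) ∧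
    (∀ F : ι → ℕ → Euc N → ℝ, (∀ i, IsFundamental (F i) (Uα i)) →
      (∀ i j, (Uα i ∩ Uα j).Nonempty → SimTo (F i) (F j) (Uα i ∩ Uα j)) →
      ∃ f : ℕ → Euc N → ℝ, IsFundamental f (⋃ i, Uα i) ∧
        ∀ i, SimTo f (F i) (Uα i)) := by
  refine ⟨fun f g hf hg h => ?_, fun F hF hS => ?_⟩
  · refine simTo_of_locNull (locNull_iUnion hopen (fun i n => ?_) fun i => (h i).locNull)
    exact ((hf.1 n).sub (hg.1 n)).mono (Set.subset_iUnion _ i)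
  have hFc : ∀ i n, ContinuousOn (F i n) (Uα i) := fun i => (hF i).1
  have hS' : ∀ i j, LocNull atTop (fun n y => F i n y - F j n y) (Uα i ∩ Uα j) := fun i j => by
    by_cases hne : (Uα i ∩ Uα j).Nonempty
    · exact (hS i j hne).locNull
    · rw [Set.not_nonempty_iff_eq_empty.1 hne]
      exact locNull_empty _ _
  have hcross : ∀ i j, LocNull (atTop : Filter (ℕ × ℕ)) (fun p y => F i p.1 y - F j p.2 y)
      (Uα i ∩ Uα j) := fun i j =>
    cross_locNull ((hopen i).inter (hopen j)) (fun n => (hFc i n).mono Set.inter_subset_left)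
      (fun n => (hFc j n).mono Set.inter_subset_right)
      (((hF i).locNull (hopen i)).mono Set.inter_subset_left) (hS' i j)
  -- it suffices to find `f` with `f ∼ F i` on each `U i`
  suffices hmain : ∃ f : ℕ → Euc N → ℝ, (∀ n, Continuous (f n)) ∧
      ∀ i, LocNull atTop (fun n y => f n y - F i n y) (Uα i) by
    obtain ⟨f, hf, hfF⟩ := hmain
    refine ⟨f, isFundamental_of_locNull (isOpen_iUnion hopen) (fun n => (hf n).continuousOn)
      (locNull_iUnion hopen (fun i p => ((hf p.1).sub (hf p.2)).continuousOn) fun i => ?_),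
      fun i => simTo_of_locNull (hfF i)⟩
    have h1 := (hfF i).comp tendsto_fst_nat
    have h2 := ((hfF i).comp tendsto_snd_nat).neg
    have h3 := (hF i).locNull (hopen i)
    have c1 : ∀ n, ContinuousOn (fun y => f n y - F i n y) (Uα i) := fun n =>
      (hf n).continuousOn.sub (hFc i n)
    have c2 : ∀ p : ℕ × ℕ, ContinuousOn (fun y => F i p.1 y - F i p.2 y) (Uα i) := fun p =>
      (hFc i p.1).sub (hFc i p.2)
    have h4 := LocNull.add (hopen i) (fun p : ℕ × ℕ => (c1 p.1).add (c2 p))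
      (fun p : ℕ × ℕ => (c1 p.2).neg) (LocNull.add (hopen i) (fun p : ℕ × ℕ => c1 p.1) c2 h1 h3) h2
    convert h4 using 3
    simp only [Pi.add_apply, Pi.neg_apply]
    ring
  -- countable cover by balls
  rcases Set.eq_empty_or_nonempty (⋃ i, Uα i) with hemp | hne
  · refine ⟨fun _ _ => 0, fun _ => continuous_const, fun i => ?_⟩
    rw [Set.iUnion_eq_empty.1 hemp i]
    exact locNull_empty _ _
  have h1 : ∀ x : Euc N, ∃ i : ι, ∃ r : ℝ, 0 < r ∧
      (x ∈ ⋃ i, Uα i → closedBall x r ⊆ Uα i) := fun x => by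
    by_cases hx : x ∈ ⋃ i, Uα i
    · obtain ⟨i, hi⟩ := Set.mem_iUnion.1 hx
      obtain ⟨r, hr, hs⟩ := Metric.nhds_basis_closedBall.mem_iff.1 ((hopen i).mem_nhds hi)
      exact ⟨i, r, hr, fun _ => hs⟩
    · obtain ⟨y, hy⟩ := hne
      obtain ⟨i, hi⟩ := Set.mem_iUnion.1 hy
      exact ⟨i, 1, one_pos, fun h => absurd h hx⟩
  choose i r hr hs using h1
  obtain ⟨T, hTU, hTc, hT⟩ := TopologicalSpace.countable_cover_nhdsWithin
    (f := fun x => ball x (r x)) (s := ⋃ i, Uα i)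
    (fun x _ => mem_nhdsWithin_of_mem_nhds (ball_mem_nhds x (hr x)))
  have hTne : T.Nonempty := by
    obtain ⟨y, hy⟩ := hne
    obtain ⟨t, ht, _⟩ := Set.mem_iUnion₂.1 (hT hy)
    exact ⟨t, ht⟩
  obtain ⟨e, he⟩ := hTc.exists_eq_range hTne
  have heU : ∀ j, e j ∈ ⋃ i, Uα i := fun j => hTU (he ▸ Set.mem_range_self j)
  obtain ⟨f, hf, hfG⟩ := glue (L := fun j => closedBall (e j) (r (e j)))
    (V := fun j => Uα (i (e j))) (G := fun j => F (i (e j))) (fun j => hopen _)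
    (fun j => isCompact_closedBall _ _) (fun j => hs _ (heU j)) (fun j n => hFc _ n)
    (fun j k => hcross _ _)
  refine ⟨f, hf, fun a => ?_⟩
  have hcov : Uα a = ⋃ j, Uα a ∩ ball (e j) (r (e j)) := by
    rw [← Set.inter_iUnion, eq_comm, Set.inter_eq_left]
    intro x hx
    obtain ⟨t, ht, hxt⟩ := Set.mem_iUnion₂.1 (hT (Set.mem_iUnion.2 ⟨a, hx⟩))
    rw [he] at ht
    obtain ⟨j, rfl⟩ := ht
    exact Set.mem_iUnion.2 ⟨j, hxt⟩
  rw [hcov]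
  refine locNull_iUnion (fun j => (hopen a).inter isOpen_ball)
    (fun j n => (hf n).continuousOn.sub ((hFc a n).mono Set.inter_subset_left)) fun j => ?_
  have hbU : ball (e j) (r (e j)) ⊆ Uα (i (e j)) := ball_subset_closedBall.trans (hs _ (heU j))
  have g1 : LocNull atTop (fun n y => f n y - F (i (e j)) n y) (Uα a ∩ ball (e j) (r (e j))) :=
    (hfG j).mono (Set.inter_subset_right.trans ball_subset_interior_closedBall)
  have g2 : LocNull atTop (fun n y => F (i (e j)) n y - F a n y)
      (Uα a ∩ ball (e j) (r (e j))) :=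
    (hS' (i (e j)) a).mono fun x hx => ⟨hbU hx.2, hx.1⟩
  have d1 : ∀ n, ContinuousOn (F (i (e j)) n) (Uα a ∩ ball (e j) (r (e j))) := fun n =>
    (hFc _ n).mono (Set.inter_subset_right.trans hbU)
  have d2 : ∀ n, ContinuousOn (F a n) (Uα a ∩ ball (e j) (r (e j))) := fun n =>
    (hFc _ n).mono Set.inter_subset_left
  have g3 := LocNull.add ((hopen a).inter isOpen_ball)
    (fun n => (hf n).continuousOn.sub (d1 n)) (fun n => (d1 n).sub (d2 n)) g1 g2
  simpa using g3
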